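/- Let G be the free metabelian group of rank n ≥ 2 and let d ∈ G'. If for every element v ∈ G not lying in G' there exists c ∈ G' such that d = ⁅c, v⁆, then d = 1. -/

import Mathlib

/-- The commutator ⁅a,b⁆ = a⁻¹b⁻¹ab (paper convention). -/
def pcomm {G : Type*} [Group G] (a b : G) : G := a⁻¹ * b⁻¹ * a * b

instance (n : ℕ) : (derivedSeries (FreeGroup (Fin n)) 2).Normal :=
  derivedSeries_normal _ _

/-- The free metabelian group of rank n: the quotient of the free group on n
generators by its second derived subgroup. -/
def freeMetabelian (n : ℕ) :=
  FreeGroup (Fin n) ⧸ derivedSeries (FreeGroup (Fin n)) 2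

instance (n : ℕ) : Group (freeMetabelian n) :=
  inferInstanceAs (Group (FreeGroup (Fin n) ⧸ derivedSeries (FreeGroup (Fin n)) 2))

/-- The images of the standard generators of the free group in the free
metabelian group. -/
def xgen (n : ℕ) (i : Fin n) : freeMetabelian n :=
  QuotientGroup.mk (FreeGroup.of i)

namespace MagnusEmbedding

variable {α : Type*}

/-- Integral 1-chains on the Cayley graph of the free abelian group on `α`, where `(a, i)` is the
edge from `a` to `a * xᵢ`. -/
abbrev Chain (α : Type*) : Type _ := Abelianization (FreeGroup α) × α →₀ ℤ

/-- Translation of chains by an element of the free abelian group. -/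
noncomputable def translate (a : Abelianization (FreeGroup α)) : Chain α ≃+ Chain α :=
  Finsupp.domCongr ((Equiv.mulLeft a).prodCongr (Equiv.refl α))

@[simp]
lemma translate_single (a b : Abelianization (FreeGroup α)) (i : α) (k : ℤ) :
    translate a (Finsupp.single (b, i) k) = Finsupp.single (a * b, i) k := by
  simp [translate, Finsupp.domCongr_apply, Finsupp.equivMapDomain_single]

@[simp]
lemma translate_one (t : Chain α) : translate 1 t = t := by
  induction t using Finsupp.induction_linear with
  | zero => exact map_zero _
  | add s t hs ht => rw [map_add, hs, ht]
  | single e k => cases e; simp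

lemma translate_mul (a b : Abelianization (FreeGroup α)) (t : Chain α) :
    translate (a * b) t = translate a (translate b t) := by
  induction t using Finsupp.induction_linear with
  | zero => simp only [map_zero]
  | add s t hs ht => simp only [map_add, hs, ht]
  | single e k => cases e; simp [mul_assoc]

/-- The action of the free abelian group on chains by translation. -/
noncomputable def translateHom (α : Type*) :
    Abelianization (FreeGroup α) →* MulAut (Multiplicative (Chain α)) where
  toFun a := AddEquiv.toMultiplicative (translate a)
  map_one' := MulEquiv.ext fun t => translate_one t.toAdd
  map_mul' a b := MulEquiv.ext fun t => translate_mul a b t.toAdd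

/-- The Magnus homomorphism, sending a word to the chain of the path it spells together with the
endpoint of that path. -/
noncomputable def magnus (α : Type*) :
    FreeGroup α →* Multiplicative (Chain α) ⋊[translateHom α] Abelianization (FreeGroup α) :=
  FreeGroup.lift fun i =>
    ⟨Multiplicative.ofAdd (Finsupp.single (1, i) 1), Abelianization.of (FreeGroup.of i)⟩

/-- The chain of the path spelled by a word. -/
noncomputable def flow (w : FreeGroup α) : Chain α := (magnus α w).left.toAdd

lemma magnus_right (w : FreeGroup α) : (magnus α w).right = Abelianization.of w := by
  have : SemidirectProduct.rightHom.comp (magnus α) = Abelianization.of := by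
    ext i
    simp [magnus]
  exact DFunLike.congr_fun this w

@[simp]
lemma flow_of (i : α) : flow (FreeGroup.of i) = Finsupp.single (1, i) 1 := by
  simp [flow, magnus]

@[simp]
lemma flow_one : flow (1 : FreeGroup α) = 0 := by
  simp [flow]

lemma flow_mul (v w : FreeGroup α) :
    flow (v * w) = flow v + translate (Abelianization.of v) (flow w) := by
  simp only [flow, map_mul, SemidirectProduct.mul_left, magnus_right]
  rfl

lemma flow_inv (w : FreeGroup α) :
    flow w⁻¹ = -translate (Abelianization.of w)⁻¹ (flow w) := by
  have h := flow_mul w⁻¹ w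
  rw [inv_mul_cancel, flow_one, map_inv] at h
  exact eq_neg_of_add_eq_zero_left h.symm

lemma abelianization_of_eq_one_iff {G : Type*} [Group G] {g : G} :
    Abelianization.of g = 1 ↔ g ∈ commutator G :=
  QuotientGroup.eq_one_iff g

lemma flow_mul_of_mem {v : FreeGroup α} (hv : v ∈ commutator (FreeGroup α)) (w : FreeGroup α) :
    flow (v * w) = flow v + flow w := by
  rw [flow_mul, abelianization_of_eq_one_iff.2 hv, translate_one]

lemma flow_pcomm_of_mem {c : FreeGroup α} (hc : c ∈ commutator (FreeGroup α))
    (v : FreeGroup α) :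
    flow (pcomm c v) = translate (Abelianization.of v)⁻¹ (flow c) - flow c := by
  have hc' := abelianization_of_eq_one_iff.2 hc
  simp only [pcomm, flow_mul, flow_inv, map_mul, map_inv, hc']
  simp
  abel

lemma derivedSeries_two_eq (G : Type*) [Group G] :
    derivedSeries G 2 = ⁅commutator G, commutator G⁆ := by
  rw [derivedSeries_succ, derivedSeries_one]

/-- The flow vanishes on the second derived subgroup. -/
lemma flow_eq_zero_of_mem {w : FreeGroup α} (hw : w ∈ derivedSeries (FreeGroup α) 2) :
    flow w = 0 := by
  have hle : derivedSeries (FreeGroup α) 2 ≤ (magnus α).ker := by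
    rw [derivedSeries_two_eq, Subgroup.commutator_le]
    intro a ha b hb
    rw [MonoidHom.mem_ker, map_commutatorElement, commutatorElement_eq_one_iff_mul_comm,
      ← map_mul, ← map_mul]
    refine SemidirectProduct.ext ?_
      (by rw [magnus_right, magnus_right, map_mul, map_mul, mul_comm])
    have h : flow (a * b) = flow (b * a) := by
      rw [flow_mul_of_mem ha, flow_mul_of_mem hb, add_comm]
    exact h
  have h : magnus α w = 1 := hle hw
  simp [flow, h]

/-- The loop at the base point that runs to `a` along the chosen path, follows `w`, and comes back
along the chosen path. -/
noncomputable def loop (a : Abelianization (FreeGroup α)) (w : FreeGroup α) :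
    commutator (FreeGroup α) :=
  ⟨a.out * w * (a * Abelianization.of w).out⁻¹, by
    have hout (b : Abelianization (FreeGroup α)) : Abelianization.of b.out = b :=
      Quotient.out_eq' b
    rw [← abelianization_of_eq_one_iff]
    simp [hout]⟩

lemma loop_mul (a : Abelianization (FreeGroup α)) (v w : FreeGroup α) :
    loop a (v * w) = loop a v * loop (a * Abelianization.of v) w := by
  ext
  simp [loop, mul_assoc]

/-- The homology class of a chain relative to the chosen paths. -/
noncomputable def chainClass (α : Type*) :
    Chain α →+ Additive (Abelianization (commutator (FreeGroup α))) :=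
  Finsupp.liftAddHom fun e => zmultiplesHom _
    (Additive.ofMul (Abelianization.of (loop e.1 (FreeGroup.of e.2))))

lemma chainClass_flow (w : FreeGroup α) : ∀ a : Abelianization (FreeGroup α),
    chainClass α (translate a (flow w)) = Additive.ofMul (Abelianization.of (loop a w)) := by
  have hone (a : Abelianization (FreeGroup α)) : loop a 1 = 1 := by
    ext
    simp [loop]
  induction w using FreeGroup.induction_on with
  | C1 => simp [hone]
  | of i => simp [chainClass]
  | inv_of i ih =>
    intro a
    have h := loop_mul a (FreeGroup.of i)⁻¹ (FreeGroup.of i)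
    rw [inv_mul_cancel, hone, map_inv] at h
    rw [flow_inv, map_neg, map_neg, ← translate_mul, ih, ← ofMul_inv, ← map_inv,
      eq_inv_of_mul_eq_one_left h.symm]
  | mul v w hv hw =>
    intro a
    rw [flow_mul, map_add, map_add, ← translate_mul, hv, hw, loop_mul, map_mul, ofMul_mul]

/-- Faithfulness of the Magnus embedding. -/
lemma mem_derivedSeries_of_flow_eq_zero {w : FreeGroup α} (hw : w ∈ commutator (FreeGroup α))
    (h : flow w = 0) : w ∈ derivedSeries (FreeGroup α) 2 := by
  have hcl := chainClass_flow w 1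
  rw [h, map_zero, map_zero] at hcl
  have hmem : loop 1 w ∈ commutator (commutator (FreeGroup α)) :=
    abelianization_of_eq_one_iff.1 (Additive.ofMul.injective hcl.symm)
  have hmem' := Subgroup.mem_map_of_mem (commutator (FreeGroup α)).subtype hmem
  rw [Subgroup.map_subtype_commutator, ← derivedSeries_two_eq] at hmem'
  have hconj : (1 : Abelianization (FreeGroup α)).out * w *
      (1 : Abelianization (FreeGroup α)).out⁻¹ ∈ derivedSeries (FreeGroup α) 2 := by
    simpa [loop, abelianization_of_eq_one_iff.2 hw] using hmem'
  simpa using (derivedSeries_normal (FreeGroup α) 2).mem_comm hconj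

/-- The exponent sum of `xᵢ`. -/
noncomputable def exponentSum [DecidableEq α] (i : α) :
    Abelianization (FreeGroup α) →* Multiplicative ℤ :=
  Abelianization.lift (FreeGroup.lift fun j => Multiplicative.ofAdd (if j = i then 1 else 0))

lemma exponentSum_of_pow [DecidableEq α] (i : α) (m : ℕ) :
    (exponentSum i (Abelianization.of (FreeGroup.of i ^ m))).toAdd = m := by
  simp [exponentSum]

/-- A chain that, for every `m > 0`, is the difference of a chain and its translate by `xᵢ ^ (-m)`
is zero. -/
lemma eq_zero_of_forall_exists_translate_sub [DecidableEq α] (i : α) (t : Chain α)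
    (h : ∀ m : ℕ, 0 < m → ∃ u : Chain α,
      t = translate (Abelianization.of (FreeGroup.of i ^ m))⁻¹ u - u) : t = 0 := by
  let e (p : Abelianization (FreeGroup α) × α) : ℤ := (exponentSum i p.1).toAdd
  obtain ⟨N, hN⟩ : ∃ N : ℕ, ∀ p ∈ t.support, (e p).natAbs ≤ N :=
    ⟨t.support.sup fun p => (e p).natAbs, fun p hp => Finset.le_sup (f := fun p => (e p).natAbs) hp⟩
  obtain ⟨u, hu⟩ := h (2 * N + 1) (by omega)
  set g := Abelianization.of (FreeGroup.of i ^ (2 * N + 1)) with hg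
  let q (p : Abelianization (FreeGroup α) × α) :
      (Abelianization (FreeGroup α) ⧸ Subgroup.zpowers g) × α := (p.1, p.2)
  have hq : Finsupp.mapDomain q t = 0 := by
    have hshift : Finsupp.mapDomain q (translate g⁻¹ u) = Finsupp.mapDomain q u := by
      rw [translate, Finsupp.domCongr_apply, Finsupp.equivMapDomain_eq_mapDomain,
        ← Finsupp.mapDomain_comp]
      congr 1
      ext p
      · simp only [q, Function.comp_apply, Equiv.prodCongr_apply, Prod.map_fst,
          Equiv.coe_mulLeft]
        rw [QuotientGroup.eq]
        simp
      · rfl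
    rw [hu, sub_eq_add_neg, Finsupp.mapDomain_add, hshift, ← Finsupp.mapDomain_add,
      add_neg_cancel, Finsupp.mapDomain_zero]
  refine Finsupp.mapDomain_injOn (S := (t.support : Set _)) (f := q) ?_ ?_ ?_ ?_
  · rintro ⟨a, j⟩ ha ⟨b, k⟩ hb hab
    simp only [q, Prod.mk.injEq] at hab
    obtain ⟨hab, rfl⟩ := hab
    obtain ⟨z, hz⟩ := Subgroup.mem_zpowers_iff.1 (QuotientGroup.eq.1 hab)
    have hez : z * (2 * N + 1) = e (b, j) - e (a, j) := by
      have := congrArg (fun x => (exponentSum i x).toAdd) hz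
      simp only [map_zpow, map_mul, map_inv, toAdd_zpow, toAdd_mul, toAdd_inv, hg,
        exponentSum_of_pow, smul_eq_mul] at this
      push_cast at this
      linarith
    have h₁ := hN _ ha
    have h₂ := hN _ hb
    have hz0 : z = 0 := by
      have hlt : |z * (2 * N + 1)| < 2 * N + 1 := by
        rw [hez, abs_lt]
        omega
      rw [abs_mul, abs_of_nonneg (by positivity : (0 : ℤ) ≤ 2 * N + 1)] at hlt
      by_contra hne
      nlinarith [Int.one_le_abs hne]
    rw [hz0, zpow_zero] at hz
    rw [inv_mul_eq_one.1 hz.symm]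
  · simp
  · simp
  · rw [hq, Finsupp.mapDomain_zero]

end MagnusEmbedding

open MagnusEmbedding

theorem stmt8 (n : ℕ) (hn : 2 ≤ n) (d : freeMetabelian n)
    (hd : d ∈ commutator (freeMetabelian n))
    (h : ∀ v : freeMetabelian n, v ∉ commutator (freeMetabelian n) →
      ∃ c ∈ commutator (freeMetabelian n), d = pcomm c v) :
    d = 1 := by
  let π : FreeGroup (Fin n) →* freeMetabelian n :=
    QuotientGroup.mk' (derivedSeries (FreeGroup (Fin n)) 2)
  have hπ : Function.Surjective π := QuotientGroup.mk'_surjective _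
  have hker (w : FreeGroup (Fin n)) : π w = 1 ↔ w ∈ derivedSeries (FreeGroup (Fin n)) 2 :=
    QuotientGroup.eq_one_iff w
  have hcomm : commutator (freeMetabelian n) = (commutator (FreeGroup (Fin n))).map π := by
    rw [commutator_def, commutator_def, Subgroup.map_commutator,
      Subgroup.map_top_of_surjective π hπ]
  rw [hcomm] at hd
  obtain ⟨D, hD, rfl⟩ := hd
  rw [hker]
  refine mem_derivedSeries_of_flow_eq_zero hD ?_
  let i : Fin n := ⟨0, by omega⟩
  refine eq_zero_of_forall_exists_translate_sub i _ fun m hm => ?_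
  obtain ⟨c, hc, hdc⟩ := h (π (FreeGroup.of i ^ m)) fun hv => by
    rw [hcomm] at hv
    obtain ⟨w, hw, hwv⟩ := hv
    have hwv' : w⁻¹ * FreeGroup.of i ^ m ∈ derivedSeries (FreeGroup (Fin n)) 2 := by
      rw [← hker, map_mul, map_inv, hwv, inv_mul_cancel]
    have hmem : w⁻¹ * FreeGroup.of i ^ m ∈ commutator (FreeGroup (Fin n)) := by
      rw [← derivedSeries_one]
      exact derivedSeries_antitone _ one_le_two hwv'
    have hv := (Subgroup.mul_mem_cancel_left _ (inv_mem hw)).1 hmem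
    have := exponentSum_of_pow i m
    rw [abelianization_of_eq_one_iff.2 hv, map_one, toAdd_one] at this
    omega
  rw [hcomm] at hc
  obtain ⟨C, hC, rfl⟩ := hc
  refine ⟨flow C, ?_⟩
  rw [← flow_pcomm_of_mem hC]
  have hmem : (pcomm C (FreeGroup.of i ^ m))⁻¹ * D ∈ derivedSeries (FreeGroup (Fin n)) 2 := by
    rw [← hker, map_mul, hdc]
    simp [pcomm, mul_assoc]
  have hflow := flow_mul (pcomm C (FreeGroup.of i ^ m)) ((pcomm C (FreeGroup.of i ^ m))⁻¹ * D)
  rwa [mul_inv_cancel_left, flow_eq_zero_of_mem hmem, map_zero, add_zero] at hflow
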